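/- Let G be a groupoid and let R be a G-graded ring. The following are equivalent: (i) R is graded von Neumann regular, i.e. r ∈ rRr for all g ∈ G and r ∈ R_g; (ii) for all g ∈ G and r ∈ R_g, there exists y ∈ R_{g⁻¹} such that r = ryr; (iii) R is nearly epsilon-strongly G-graded and R_e is a von Neumann regular ring for every object e ∈ ob(G). -/

import Mathlib

open scoped Pointwise
open CategoryTheory

/-- The set of morphisms of a groupoid `G` (with object type `Ob`), encoded as triples
`⟨a, b, g⟩` where `g : a ⟶ b`; thus `d(⟨a,b,g⟩) = a` and `c(⟨a,b,g⟩) = b`. -/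
def GroupoidMor (Ob : Type*) [Groupoid Ob] : Type _ := Σ a b : Ob, a ⟶ b

/-- The inverse morphism: if `g : a ⟶ b` then `g⁻¹ : b ⟶ a`. -/
def GroupoidMor.inv {Ob : Type*} [Groupoid Ob] (g : GroupoidMor Ob) : GroupoidMor Ob :=
  ⟨g.2.1, g.1, Groupoid.inv g.2.2⟩

/-- The product `A B` of two additive subgroups of a ring: the additive subgroup
generated by all products `a * b` with `a ∈ A`, `b ∈ B`. -/
def subgroupMul {R : Type*} [NonUnitalRing R] (A B : AddSubgroup R) : AddSubgroup R :=
  AddSubgroup.closure ((A : Set R) * (B : Set R))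

/-- A subset `P` of `R` (closed under multiplication) is a unital ring:
it has a two-sided multiplicative identity element. -/
def HasUnity {R : Type*} [NonUnitalRing R] (P : AddSubgroup R) : Prop :=
  ∃ u ∈ P, ∀ x ∈ P, u * x = x ∧ x * u = x

/-- A subset `P` of `R` is an s-unital ring: `x ∈ Px` and `x ∈ xP` for every `x ∈ P`. -/
def IsSUnital {R : Type*} [NonUnitalRing R] (P : AddSubgroup R) : Prop :=
  ∀ x ∈ P, (∃ u ∈ P, u * x = x) ∧ (∃ v ∈ P, x * v = x)

/-- A subset `P` of `R` is a von Neumann regular ring: `r ∈ rPr` for every `r ∈ P`. -/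
def IsVonNeumannRegular {R : Type*} [NonUnitalRing R] (P : AddSubgroup R) : Prop :=
  ∀ r ∈ P, ∃ x ∈ P, r = r * x * r

/-- `R` is a `G`-graded ring via the family `𝒜` of additive subgroups indexed by the
morphisms of the groupoid `G`: `R = ⊕_{g ∈ G} R_g` (internal direct sum),
`R_g R_h ⊆ R_{gh}` for composable pairs `(g,h)` (i.e. `d(g) = c(h)`), and
`R_g R_h = {0}` for non-composable pairs. -/
structure IsGroupoidGrading {Ob R : Type*} [Groupoid Ob] [DecidableEq (GroupoidMor Ob)]
    [NonUnitalRing R] (𝒜 : GroupoidMor Ob → AddSubgroup R) : Prop where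
  internal : DirectSum.IsInternal 𝒜
  mul_mem : ∀ (a b c : Ob) (g : b ⟶ c) (h : a ⟶ b),
    ∀ x ∈ 𝒜 ⟨b, c, g⟩, ∀ y ∈ 𝒜 ⟨a, b, h⟩, x * y ∈ 𝒜 ⟨a, c, h ≫ g⟩
  mul_eq_zero : ∀ g h : GroupoidMor Ob, g.1 ≠ h.2.1 →
    ∀ x ∈ 𝒜 g, ∀ y ∈ 𝒜 h, x * y = 0

/-- `R` is symmetrically `G`-graded: `R_g = R_g R_{g⁻¹} R_g` for every morphism `g`. -/
def SymmetricallyGroupoidGraded {Ob R : Type*} [Groupoid Ob] [NonUnitalRing R]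
    (𝒜 : GroupoidMor Ob → AddSubgroup R) : Prop :=
  ∀ g : GroupoidMor Ob, 𝒜 g = subgroupMul (subgroupMul (𝒜 g) (𝒜 g.inv)) (𝒜 g)

/-- `R` is epsilon-strongly `G`-graded: symmetrically `G`-graded and `R_g R_{g⁻¹}`
is unital for every morphism `g`. -/
def EpsilonStronglyGroupoidGraded {Ob R : Type*} [Groupoid Ob] [NonUnitalRing R]
    (𝒜 : GroupoidMor Ob → AddSubgroup R) : Prop :=
  SymmetricallyGroupoidGraded 𝒜 ∧ ∀ g : GroupoidMor Ob, HasUnity (subgroupMul (𝒜 g) (𝒜 g.inv))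

/-- `R` is nearly epsilon-strongly `G`-graded: symmetrically `G`-graded and
`R_g R_{g⁻¹}` is s-unital for every morphism `g`. -/
def NearlyEpsilonStronglyGroupoidGraded {Ob R : Type*} [Groupoid Ob] [NonUnitalRing R]
    (𝒜 : GroupoidMor Ob → AddSubgroup R) : Prop :=
  SymmetricallyGroupoidGraded 𝒜 ∧
    ∀ g : GroupoidMor Ob, IsSUnital (subgroupMul (𝒜 g) (𝒜 g.inv))

section SubgroupMul

variable {R : Type*} [NonUnitalRing R]

theorem mul_mem_subgroupMul {A B : AddSubgroup R} {a b : R} (ha : a ∈ A) (hb : b ∈ B) :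
    a * b ∈ subgroupMul A B :=
  AddSubgroup.subset_closure (Set.mul_mem_mul ha hb)

@[elab_as_elim]
theorem subgroupMul_induction {A B : AddSubgroup R} {p : ∀ x, x ∈ subgroupMul A B → Prop}
    (mul : ∀ a (ha : a ∈ A) b (hb : b ∈ B), p (a * b) (mul_mem_subgroupMul ha hb))
    (zero : p 0 (zero_mem _))
    (add : ∀ x y hx hy, p x hx → p y hy → p (x + y) (add_mem hx hy))
    (neg : ∀ x hx, p x hx → p (-x) (neg_mem hx)) {x : R} (hx : x ∈ subgroupMul A B) :
    p x hx := by
  refine AddSubgroup.closure_induction ?_ zero add neg hx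
  rintro _ ⟨a, ha, b, hb, rfl⟩
  exact mul a ha b hb

theorem subgroupMul_le {A B C : AddSubgroup R} (h : ∀ a ∈ A, ∀ b ∈ B, a * b ∈ C) :
    subgroupMul A B ≤ C := by
  rw [subgroupMul, AddSubgroup.closure_le]
  rintro _ ⟨a, ha, b, hb, rfl⟩
  exact h a ha b hb

theorem subgroupMul_assoc_le (A B C : AddSubgroup R) :
    subgroupMul (subgroupMul A B) C ≤ subgroupMul A (subgroupMul B C) := by
  refine subgroupMul_le fun x hx c hc => ?_
  induction hx using subgroupMul_induction with
  | mul a ha b hb =>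
    rw [mul_assoc]
    exact mul_mem_subgroupMul ha (mul_mem_subgroupMul hb hc)
  | zero => simp
  | add x y _ _ hx hy => rw [add_mul]; exact add_mem hx hy
  | neg x _ hx => rw [neg_mul]; exact neg_mem hx

theorem mul_mem_subgroupMul_left {A B E : AddSubgroup R} (hEA : ∀ e ∈ E, ∀ a ∈ A, e * a ∈ A)
    {e x : R} (he : e ∈ E) (hx : x ∈ subgroupMul A B) : e * x ∈ subgroupMul A B := by
  induction hx using subgroupMul_induction with
  | mul a ha b hb => rw [← mul_assoc]; exact mul_mem_subgroupMul (hEA e he a ha) hb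
  | zero => simp
  | add x y _ _ hx hy => rw [mul_add]; exact add_mem hx hy
  | neg x _ hx => rw [mul_neg]; exact neg_mem hx

theorem mul_mem_subgroupMul_right {A B E : AddSubgroup R} (hBE : ∀ b ∈ B, ∀ e ∈ E, b * e ∈ B)
    {e x : R} (he : e ∈ E) (hx : x ∈ subgroupMul A B) : x * e ∈ subgroupMul A B := by
  induction hx using subgroupMul_induction with
  | mul a ha b hb => rw [mul_assoc]; exact mul_mem_subgroupMul ha (hBE b hb e he)
  | zero => simp
  | add x y _ _ hx hy => rw [add_mul]; exact add_mem hx hy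
  | neg x _ hx => rw [neg_mul]; exact neg_mem hx

/-- A two-sided ideal of a von Neumann regular ring is s-unital. -/
theorem IsVonNeumannRegular.isSUnital_of_ideal {E I : AddSubgroup R}
    (hE : IsVonNeumannRegular E) (hIE : I ≤ E) (hl : ∀ e ∈ E, ∀ x ∈ I, e * x ∈ I)
    (hr : ∀ e ∈ E, ∀ x ∈ I, x * e ∈ I) : IsSUnital I := by
  intro x hx
  obtain ⟨y, hy, hxy⟩ := hE x (hIE hx)
  exact ⟨⟨x * y, hr y hy x hx, hxy.symm⟩, y * x, hl y hy x hx, by rw [← mul_assoc, ← hxy]⟩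

/-- Every element of `A I` has a right unit in `I` when `I` is s-unital. -/
theorem IsSUnital.exists_mul_eq {A I : AddSubgroup R} (hI : IsSUnital I)
    (hmul : ∀ x ∈ I, ∀ y ∈ I, x * y ∈ I) {r : R} (hr : r ∈ subgroupMul A I) :
    ∃ u ∈ I, r * u = r := by
  suffices h : ∀ u ∈ I, ∃ u' ∈ I, r * u' = r ∧ ∀ x, x * u = x → x * u' = x by
    obtain ⟨u, hu, hru, -⟩ := h 0 I.zero_mem
    exact ⟨u, hu, hru⟩
  induction hr using subgroupMul_induction with
  | mul a ha v hv =>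
    intro u hu
    obtain ⟨-, w, hw, hvw⟩ := hI (v - v * u) (I.sub_mem hv (hmul v hv u hu))
    refine ⟨u + w - u * w, I.sub_mem (I.add_mem hu hw) (hmul u hu w hw), ?_, fun x hx => ?_⟩
    · have : v * (u + w - u * w) = v * u + (v - v * u) * w := by noncomm_ring
      rw [mul_assoc, this, hvw, add_sub_cancel]
    · rw [mul_sub, mul_add, ← mul_assoc, hx, add_sub_cancel_right]
  | zero => exact fun u hu => ⟨u, hu, zero_mul u, fun _ => id⟩
  | add x y _ _ hx hy =>
    intro u hu
    obtain ⟨u₁, hu₁, hxu, h₁⟩ := hx u hu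
    obtain ⟨u₂, hu₂, hyu, h₂⟩ := hy u₁ hu₁
    exact ⟨u₂, hu₂, by rw [add_mul, h₂ x hxu, hyu], fun z hz => h₂ z (h₁ z hz)⟩
  | neg x _ hx =>
    intro u hu
    obtain ⟨u₁, hu₁, hxu, h₁⟩ := hx u hu
    exact ⟨u₁, hu₁, by rw [neg_mul, hxu], h₁⟩

/-- If `A B` lies in a von Neumann regular ring `E` acting on `B` from the right, then for
`r ∈ A` every element of `r B A` is fixed by left multiplication by some `r w` with `w ∈ B`. -/
theorem IsVonNeumannRegular.exists_mul_mul_eq {A B E : AddSubgroup R}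
    (hE : IsVonNeumannRegular E) (hAB : ∀ a ∈ A, ∀ b ∈ B, a * b ∈ E)
    (hBE : ∀ b ∈ B, ∀ e ∈ E, b * e ∈ B) {r u : R} (hr : r ∈ A) (hu : u ∈ subgroupMul B A) :
    ∃ w ∈ B, r * w * (r * u) = r * u := by
  suffices h : ∀ w ∈ B, ∃ w' ∈ B, r * w' * (r * u) = r * u ∧
      ∀ x, r * w * x = x → r * w' * x = x by
    obtain ⟨w, hw, hwu, -⟩ := h 0 B.zero_mem
    exact ⟨w, hw, hwu⟩
  induction hu using subgroupMul_induction with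
  | mul b hb a ha =>
    intro w hw
    have hb' : b - w * (r * b) ∈ B := B.sub_mem hb (hBE w hw _ (hAB r hr b hb))
    obtain ⟨y, hy, hzy⟩ := hE _ (hAB r hr _ hb')
    set c := b - w * (r * b) with hc
    have hcy : c * y ∈ B := hBE c hb' y hy
    have key : ∀ x, r * (w + c * y - c * y * (r * w)) * x =
        r * w * x + r * c * y * (x - r * w * x) := fun x => by noncomm_ring
    refine ⟨w + c * y - c * y * (r * w),
      B.sub_mem (B.add_mem hw hcy) (hBE _ hcy _ (hAB r hr w hw)), ?_, fun x hx => ?_⟩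
    · have hz : r * b - r * w * (r * b) = r * c := by rw [hc]; noncomm_ring
      rw [← mul_assoc r b a, ← mul_assoc _ (r * b) a, key, hz, ← hzy, ← hz, add_sub_cancel]
    · rw [key, hx, sub_self, mul_zero, add_zero]
  | zero => exact fun w hw => ⟨w, hw, by simp, fun _ => id⟩
  | add x y _ _ hx hy =>
    intro w hw
    obtain ⟨w₁, hw₁, hxw, h₁⟩ := hx w hw
    obtain ⟨w₂, hw₂, hyw, h₂⟩ := hy w₁ hw₁
    exact ⟨w₂, hw₂, by rw [mul_add, mul_add, h₂ _ hxw, hyw], fun z hz => h₂ z (h₁ z hz)⟩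
  | neg x _ hx =>
    intro w hw
    obtain ⟨w₁, hw₁, hxw, h₁⟩ := hx w hw
    exact ⟨w₁, hw₁, by rw [mul_neg, mul_neg, hxw], h₁⟩

end SubgroupMul

theorem GroupoidMor.inv_inv {Ob : Type*} [Groupoid Ob] (g : GroupoidMor Ob) : g.inv.inv = g := by
  obtain ⟨a, b, f⟩ := g
  simp only [GroupoidMor.inv, Groupoid.inv_eq_inv, IsIso.inv_inv]
  rfl

namespace IsGroupoidGrading

variable {Ob R : Type*} [Groupoid Ob] [DecidableEq (GroupoidMor Ob)] [NonUnitalRing R]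
  {𝒜 : GroupoidMor Ob → AddSubgroup R}

theorem mul_inv_mem (hgr : IsGroupoidGrading 𝒜) (g : GroupoidMor Ob) {x y : R} (hx : x ∈ 𝒜 g)
    (hy : y ∈ 𝒜 g.inv) : x * y ∈ 𝒜 ⟨g.2.1, g.2.1, 𝟙 _⟩ := by
  have := hgr.mul_mem _ _ _ g.2.2 (Groupoid.inv g.2.2) x hx y hy
  rwa [Groupoid.inv_comp] at this

theorem id_mul_mem (hgr : IsGroupoidGrading 𝒜) (g : GroupoidMor Ob) {e x : R}
    (he : e ∈ 𝒜 ⟨g.2.1, g.2.1, 𝟙 _⟩) (hx : x ∈ 𝒜 g) : e * x ∈ 𝒜 g := by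
  have := hgr.mul_mem _ _ _ (𝟙 g.2.1) g.2.2 e he x hx
  rwa [Category.comp_id] at this

theorem mul_id_mem (hgr : IsGroupoidGrading 𝒜) (g : GroupoidMor Ob) {e x : R}
    (he : e ∈ 𝒜 ⟨g.1, g.1, 𝟙 _⟩) (hx : x ∈ 𝒜 g) : x * e ∈ 𝒜 g := by
  have := hgr.mul_mem _ _ _ g.2.2 (𝟙 g.1) x hx e he
  rwa [Category.id_comp] at this

theorem mul_mul_mem_iSup_ne (hgr : IsGroupoidGrading 𝒜) {g h : GroupoidMor Ob} (hne : h ≠ g.inv)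
    {r x : R} (hr : r ∈ 𝒜 g) (hx : x ∈ 𝒜 h) : r * x * r ∈ ⨆ k, ⨆ _ : k ≠ g, 𝒜 k := by
  obtain ⟨a, b, f⟩ := g
  obtain ⟨c, d, k⟩ := h
  by_cases had : a = d
  swap
  · rw [hgr.mul_eq_zero ⟨a, b, f⟩ ⟨c, d, k⟩ had r hr x hx, zero_mul]
    exact zero_mem _
  by_cases hcb : c = b
  swap
  · rw [mul_assoc, hgr.mul_eq_zero ⟨c, d, k⟩ ⟨a, b, f⟩ hcb x hx r hr, mul_zero]
    exact zero_mem _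
  subst had hcb
  have hmem := hgr.mul_mem _ _ _ (k ≫ f) f _ (hgr.mul_mem _ _ _ f k r hr x hx) r hr
  refine AddSubgroup.mem_iSup_of_mem _ (AddSubgroup.mem_iSup_of_mem ?_ hmem)
  intro heq
  apply hne
  have hf : f ≫ k ≫ f = f := by
    simpa using eq_of_heq (Sigma.mk.inj (eq_of_heq (Sigma.mk.inj heq).2)).2
  have hk : k = Groupoid.inv f := by
    rw [Groupoid.inv_eq_inv, ← cancel_mono f, ← cancel_epi f, hf]
    simp
  rw [hk]
  rfl

theorem exists_mem_inv_of_eq_mul_mul (hgr : IsGroupoidGrading 𝒜) {g : GroupoidMor Ob} {r x : R}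
    (hr : r ∈ 𝒜 g) (hx : r = r * x * r) : ∃ y ∈ 𝒜 g.inv, r = r * y * r := by
  have key : ∃ y ∈ 𝒜 g.inv, r * x * r - r * y * r ∈ ⨆ k, ⨆ _ : k ≠ g, 𝒜 k := by
    clear hx
    obtain ⟨x, rfl⟩ := hgr.internal.surjective x
    induction x using DirectSum.induction_on with
    | zero => exact ⟨0, zero_mem _, by simp⟩
    | of h x =>
      rw [DirectSum.coeAddMonoidHom_of]
      by_cases hne : h = g.inv
      · exact ⟨x, hne ▸ x.2, by rw [sub_self]; exact zero_mem _⟩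
      · exact ⟨0, zero_mem _, by simpa using hgr.mul_mul_mem_iSup_ne hne hr x.2⟩
    | add x₁ x₂ h₁ h₂ =>
      obtain ⟨y₁, hy₁, h₁⟩ := h₁
      obtain ⟨y₂, hy₂, h₂⟩ := h₂
      refine ⟨y₁ + y₂, add_mem hy₁ hy₂, ?_⟩
      convert add_mem h₁ h₂ using 1
      rw [map_add]
      noncomm_ring
  obtain ⟨y, hy, hxy⟩ := key
  refine ⟨y, hy, sub_eq_zero.mp ?_⟩
  rw [← hx] at hxy
  have hy' : r * y * r ∈ 𝒜 g := hgr.id_mul_mem g (hgr.mul_inv_mem g hr hy) hr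
  exact AddSubgroup.disjoint_def.mp (hgr.internal.addSubgroup_iSupIndep g)
    (sub_mem hr hy') hxy

theorem nearlyEpsilonStrongly_of_regular (hgr : IsGroupoidGrading 𝒜)
    (h : ∀ g : GroupoidMor Ob, ∀ r ∈ 𝒜 g, ∃ y ∈ 𝒜 g.inv, r = r * y * r) :
    NearlyEpsilonStronglyGroupoidGraded 𝒜 ∧
      ∀ e : Ob, IsVonNeumannRegular (𝒜 ⟨e, e, 𝟙 e⟩) := by
  have hreg : ∀ e : Ob, IsVonNeumannRegular (𝒜 ⟨e, e, 𝟙 e⟩) := fun e r hr => by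
    simpa [GroupoidMor.inv] using h ⟨e, e, 𝟙 e⟩ r hr
  have hle : ∀ g : GroupoidMor Ob, subgroupMul (𝒜 g) (𝒜 g.inv) ≤ 𝒜 ⟨g.2.1, g.2.1, 𝟙 _⟩ :=
    fun g => subgroupMul_le fun _ ha _ hb => hgr.mul_inv_mem g ha hb
  refine ⟨⟨fun g => le_antisymm (fun r hr => ?_) ?_, fun g => ?_⟩, hreg⟩
  · obtain ⟨y, hy, hry⟩ := h g r hr
    rw [hry]
    exact mul_mem_subgroupMul (mul_mem_subgroupMul hr hy) hr
  · exact subgroupMul_le fun _ hx _ ha => hgr.id_mul_mem g (hle g hx) ha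
  · exact (hreg g.2.1).isSUnital_of_ideal (hle g)
      (fun _ he _ hx =>
        mul_mem_subgroupMul_left (fun _ he _ ha => hgr.id_mul_mem g he ha) he hx)
      (fun _ he _ hx =>
        mul_mem_subgroupMul_right (fun _ hb _ he => hgr.mul_id_mem g.inv he hb) he hx)

theorem regular_of_nearlyEpsilonStrongly (hgr : IsGroupoidGrading 𝒜)
    (h : NearlyEpsilonStronglyGroupoidGraded 𝒜)
    (hreg : ∀ e : Ob, IsVonNeumannRegular (𝒜 ⟨e, e, 𝟙 e⟩))
    {g : GroupoidMor Ob} {r : R} (hr : r ∈ 𝒜 g) : ∃ x : R, r = r * x * r := by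
  have hsu := h.2 g.inv
  rw [GroupoidMor.inv_inv] at hsu
  have hle : subgroupMul (𝒜 g.inv) (𝒜 g) ≤ 𝒜 ⟨g.1, g.1, 𝟙 _⟩ :=
    subgroupMul_le fun _ hb _ ha => hgr.mul_inv_mem g.inv hb (g.inv_inv.symm ▸ ha)
  have hr' : r ∈ subgroupMul (𝒜 g) (subgroupMul (𝒜 g.inv) (𝒜 g)) :=
    subgroupMul_assoc_le _ _ _ (h.1 g ▸ hr)
  obtain ⟨u, hu, hru⟩ := hsu.exists_mul_eq
    (fun _ hx _ hy => mul_mem_subgroupMul_left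
      (fun _ he _ hb => hgr.id_mul_mem g.inv he hb) (hle hx) hy) hr'
  obtain ⟨w, -, hw⟩ := (hreg g.2.1).exists_mul_mul_eq
    (fun _ ha _ hb => hgr.mul_inv_mem g ha hb)
    (fun _ hb _ he => hgr.mul_id_mem g.inv he hb) hr hu
  rw [hru] at hw
  exact ⟨w, hw.symm⟩

end IsGroupoidGrading

/-- **Theorem (groupoid graded rings).** Let `G` be a groupoid and `R` a `G`-graded ring.
The following are equivalent: (i) `R` is graded von Neumann regular, i.e. `r ∈ rRr` for
all `g ∈ G` and `r ∈ R_g`; (ii) for all `g ∈ G` and `r ∈ R_g` there is `y ∈ R_{g⁻¹}`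
with `r = ryr`; (iii) `R` is nearly epsilon-strongly `G`-graded and `R_e` is von Neumann
regular for every object `e` of `G`. -/
theorem groupoidGraded_vonNeumannRegular_tfae
    {Ob R : Type*} [Groupoid Ob] [DecidableEq (GroupoidMor Ob)] [NonUnitalRing R]
    (𝒜 : GroupoidMor Ob → AddSubgroup R) (hgr : IsGroupoidGrading 𝒜) :
    ((∀ g : GroupoidMor Ob, ∀ r ∈ 𝒜 g, ∃ x : R, r = r * x * r) ↔
      (∀ g : GroupoidMor Ob, ∀ r ∈ 𝒜 g, ∃ y ∈ 𝒜 g.inv, r = r * y * r)) ∧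
    ((∀ g : GroupoidMor Ob, ∀ r ∈ 𝒜 g, ∃ x : R, r = r * x * r) ↔
      (NearlyEpsilonStronglyGroupoidGraded 𝒜 ∧
        ∀ e : Ob, IsVonNeumannRegular (𝒜 ⟨e, e, 𝟙 e⟩))) := by
  have h₁₂ := fun (h : ∀ g : GroupoidMor Ob, ∀ r ∈ 𝒜 g, ∃ x : R, r = r * x * r) g r hr =>
    let ⟨_, hx⟩ := h g r hr
    hgr.exists_mem_inv_of_eq_mul_mul hr hx
  exact ⟨⟨h₁₂, fun h g r hr => let ⟨y, _, hy⟩ := h g r hr; ⟨y, hy⟩⟩,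
    fun h => hgr.nearlyEpsilonStrongly_of_regular (h₁₂ h),
    fun h _ _ hr => hgr.regular_of_nearlyEpsilonStrongly h.1 h.2 hr⟩
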